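/- Let p be a prime, n a natural number, and Q a connected quandle with Nat.card Q = p^n. Then Q has a generating set of at most n + 1 elements: there exists a finite set S ⊆ Q with |S| ≤ n + 1 such that every subset T ⊆ Q that contains S and is closed under ◃ and under the inverse left translation ◃⁻¹ (a, b ∈ T implies a ◃ b ∈ T and a ◃⁻¹ b ∈ T) equals all of Q. -/

import Mathlib

open Quandles

/-- Left multiplication by `a` as a permutation of the quandle. -/
def QL {Q : Type*} [Quandle Q] (a : Q) : Equiv.Perm Q := Rack.act' a

/-- The displacement group of a quandle: the subgroup of `Equiv.Perm Q`
generated by `{L a * (L b)⁻¹ : a, b ∈ Q}`. -/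
def Dis (Q : Type*) [Quandle Q] : Subgroup (Equiv.Perm Q) :=
  Subgroup.closure {g : Equiv.Perm Q | ∃ a b : Q, g = QL a * (QL b)⁻¹}


theorem aux_trace_eq {O : Type*} [CommRing O] [IsLocalRing O] {m : Type*} [Fintype m] [DecidableEq m]
    (E F : Matrix m m O) (hE : E * E = E) (hF : F * F = F)
    (h : ∀ i j, E i j - F i j ∈ IsLocalRing.maximalIdeal O) : E.trace = F.trace := by
  set U := E * F + (1 - E) * (1 - F) with hU
  have hEU : E * U = U * F := by
    have h1 : E * U = E * F := by
      have : E * (1 - E) = 0 := by rw [mul_sub, mul_one, hE, sub_self]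
      rw [hU, mul_add, ← mul_assoc, hE, ← mul_assoc, this, zero_mul, add_zero]
    have h2 : U * F = E * F := by
      have : (1 - F) * F = 0 := by rw [sub_mul, one_mul, hF, sub_self]
      rw [hU, add_mul, mul_assoc, hF, mul_assoc, this, mul_zero, add_zero]
    rw [h1, h2]
  have hdet : IsUnit U.det := by
    let r := IsLocalRing.residue O
    have hEF : r.mapMatrix E = r.mapMatrix F := by
      ext i j
      have := h i j
      rw [← Ideal.Quotient.eq] at this
      exact this
    have hF' : r.mapMatrix F * r.mapMatrix F = r.mapMatrix F := by rw [← map_mul, hF]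
    have : r.mapMatrix U = 1 := by
      rw [hU, map_add, map_mul, map_mul, map_sub, map_sub, hEF, map_one, hF', mul_sub, sub_mul, sub_mul, hF']
      simp
    have h3 : r U.det = 1 := by rw [RingHom.map_det, this, Matrix.det_one]
    by_contra hn
    have : U.det ∈ IsLocalRing.maximalIdeal O := hn
    have := (IsLocalRing.residue_eq_zero_iff _).2 this
    have h4 : r U.det = 0 := this
    rw [h3] at h4
    exact one_ne_zero h4
  have hUU : U * U⁻¹ = 1 := Matrix.mul_nonsing_inv U hdet
  have hUU' : U⁻¹ * U = 1 := Matrix.nonsing_inv_mul U hdet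
  calc E.trace = (E * (U * U⁻¹)).trace := by rw [hUU, mul_one]
    _ = (U * F * U⁻¹).trace := by rw [← mul_assoc, hEU]
    _ = (U⁻¹ * (U * F)).trace := Matrix.trace_mul_comm _ _
    _ = F.trace := by rw [← mul_assoc, hUU', one_mul]

section
variable {O : Type*} [CommRing O] {m : Type*} [Fintype m] [DecidableEq m]

theorem aux_shift {R : Type*} [Ring R] (q : ℕ) (Y : Rˣ) (hY : Y ^ q = 1) :
    (Y : R) * (∑ j ∈ Finset.range q, ((Y ^ j : Rˣ) : R)) = ∑ j ∈ Finset.range q, ((Y ^ j : Rˣ) : R) := by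
  have h := Finset.sum_range_succ' (fun j => ((Y ^ j : Rˣ) : R)) q
  rw [Finset.sum_range_succ, hY, pow_zero] at h
  have h := add_right_cancel h
  rw [Finset.mul_sum]
  conv_rhs => rw [h]
  refine Finset.sum_congr rfl fun j _ => ?_
  rw [pow_succ']; rfl

theorem aux_idem (q : ℕ) (Y : (Matrix m m O)ˣ) (hY : Y ^ q = 1) (e s : Matrix m m O) (he : e * e = e)
    (heY : Commute e Y)
    (hs : ∑ j ∈ Finset.range q, ((Y ^ j : (Matrix m m O)ˣ) : Matrix m m O) * s * ((Y ^ j)⁻¹ : (Matrix m m O)ˣ) = 1)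
    (N : Matrix m m O) (hN : N = ∑ j ∈ Finset.range q, ((Y ^ j : (Matrix m m O)ˣ) : Matrix m m O)) :
    (N * (e * s * e)) * (N * (e * s * e)) = N * (e * s * e) ∧
    q • (N * (e * s * e)).trace = ∑ j ∈ Finset.range q, (e * ((Y ^ j : (Matrix m m O)ˣ) : Matrix m m O)).trace := by
  have heYj : ∀ j : ℕ, Commute e ((Y ^ j : (Matrix m m O)ˣ) : Matrix m m O) := fun j => by
    rw [Units.val_pow_eq_pow_val]; exact heY.pow_right j
  have heYj' : ∀ j : ℕ, Commute e (((Y ^ j)⁻¹ : (Matrix m m O)ˣ) : Matrix m m O) := fun j =>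
    (heYj j).units_inv_right
  have heN : Commute e N := by
    rw [hN]; exact Commute.sum_right _ _ _ fun j _ => heYj j
  have hYN : ∀ j : ℕ, ((Y ^ j : (Matrix m m O)ˣ) : Matrix m m O) * N = N := by
    intro j
    induction j with
    | zero => simp
    | succ k ih =>
      rw [pow_succ, Units.val_mul, mul_assoc]
      have : (Y : Matrix m m O) * N = N := by rw [hN]; exact aux_shift q Y hY
      rw [this, ih]
  have hYN' : ∀ j : ℕ, (((Y ^ j)⁻¹ : (Matrix m m O)ˣ) : Matrix m m O) * N = N := by
    intro j
    conv_lhs => rw [← hYN j]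
    rw [← mul_assoc, Units.inv_mul, one_mul]
  have hNY : ∀ j : ℕ, Commute N ((Y ^ j : (Matrix m m O)ˣ) : Matrix m m O) := by
    intro j
    rw [hN]
    refine Commute.sum_left _ _ _ fun i _ => ?_
    rw [Units.val_pow_eq_pow_val, Units.val_pow_eq_pow_val]
    exact Commute.pow_pow (Commute.refl _) _ _
  have hs' : ∑ j ∈ Finset.range q, ((Y ^ j : (Matrix m m O)ˣ) : Matrix m m O) * (e * s * e) * ((Y ^ j)⁻¹ : (Matrix m m O)ˣ) = e := by
    calc _ = ∑ j ∈ Finset.range q, e * (((Y ^ j : (Matrix m m O)ˣ) : Matrix m m O) * s * ((Y ^ j)⁻¹ : (Matrix m m O)ˣ)) * e := by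
            refine Finset.sum_congr rfl fun j _ => ?_
            have h1 := (heYj j).eq
            have h2 := (heYj' j).eq
            calc _ = (((Y ^ j : (Matrix m m O)ˣ) : Matrix m m O) * e) * s * (e * ((Y ^ j)⁻¹ : (Matrix m m O)ˣ)) := by
                    simp only [mul_assoc]
              _ = _ := by rw [← h1, h2]; simp only [mul_assoc]
      _ = e := by rw [← Finset.sum_mul, ← Finset.mul_sum, hs, mul_one, he]
  constructor
  · have key : N * (e * s * e) * N = e * N := by
      calc N * (e * s * e) * N = ∑ j ∈ Finset.range q, ((Y ^ j : (Matrix m m O)ˣ) : Matrix m m O) * (e * s * e) * N := by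
            conv_lhs => rw [mul_assoc, hN, Finset.sum_mul, ← hN]
            simp only [mul_assoc]
        _ = ∑ j ∈ Finset.range q, ((Y ^ j : (Matrix m m O)ˣ) : Matrix m m O) * (e * s * e) * ((Y ^ j)⁻¹ : (Matrix m m O)ˣ) * N := by
            refine Finset.sum_congr rfl fun j _ => ?_
            rw [mul_assoc _ (((Y ^ j)⁻¹ : (Matrix m m O)ˣ) : Matrix m m O) N, hYN' j]
        _ = e * N := by rw [← Finset.sum_mul, hs']
    rw [← mul_assoc, key, heN.eq, mul_assoc N, ← mul_assoc e, ← mul_assoc e, he]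
  · have h1 : (N * (e * s * e)).trace = (N * e * s).trace := by
      rw [← mul_assoc, Matrix.trace_mul_comm, ← mul_assoc, ← mul_assoc, heN.eq, mul_assoc N, he]
    have h2 : ∀ j : ℕ, (N * e * s).trace = (N * e * (((Y ^ j : (Matrix m m O)ˣ) : Matrix m m O) * s * ((Y ^ j)⁻¹ : (Matrix m m O)ˣ))).trace := by
      intro j
      have h3 : N * e * (((Y ^ j : (Matrix m m O)ˣ) : Matrix m m O) * s * ((Y ^ j)⁻¹ : (Matrix m m O)ˣ)) =
          ((Y ^ j : (Matrix m m O)ˣ) : Matrix m m O) * ((N * e * s) * ((Y ^ j)⁻¹ : (Matrix m m O)ˣ)) := by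
        have := ((hNY j).mul_left (heYj j)).eq
        rw [← mul_assoc, ← mul_assoc, this]; simp only [mul_assoc]
      rw [h3, Matrix.trace_mul_comm (((Y ^ j : (Matrix m m O)ˣ) : Matrix m m O)), mul_assoc _ _ ((Y ^ j : (Matrix m m O)ˣ) : Matrix m m O), Units.inv_mul, mul_one]
    calc q • (N * (e * s * e)).trace = ∑ j ∈ Finset.range q, (N * e * s).trace := by
          rw [h1, Finset.sum_const, Finset.card_range]
      _ = ∑ j ∈ Finset.range q, (N * e * (((Y ^ j : (Matrix m m O)ˣ) : Matrix m m O) * s * ((Y ^ j)⁻¹ : (Matrix m m O)ˣ))).trace :=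
          Finset.sum_congr rfl fun j _ => h2 j
      _ = (N * e).trace := by rw [← Matrix.trace_sum, ← Finset.mul_sum, hs, mul_one]
      _ = _ := by rw [← heN.eq, hN, Finset.mul_sum, Matrix.trace_sum]

theorem aux_zeta [IsLocalRing O] (q : ℕ) (Y : (Matrix m m O)ˣ) (hY : Y ^ q = 1) (e s : Matrix m m O) (he : e * e = e)
    (heY : Commute e Y)
    (hs : ∑ j ∈ Finset.range q, ((Y ^ j : (Matrix m m O)ˣ) : Matrix m m O) * s * ((Y ^ j)⁻¹ : (Matrix m m O)ˣ) = 1)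
    (z : Oˣ) (hz : z ^ q = 1) (hz1 : (z : O) - 1 ∈ IsLocalRing.maximalIdeal O) :
    ∑ j ∈ Finset.range q, (z : O) ^ j * (e * ((Y ^ j : (Matrix m m O)ˣ) : Matrix m m O)).trace =
    ∑ j ∈ Finset.range q, (e * ((Y ^ j : (Matrix m m O)ˣ) : Matrix m m O)).trace := by
  let zz : (Matrix m m O)ˣ := Units.map (algebraMap O (Matrix m m O)).toMonoidHom z
  have hzz : ∀ j : ℕ, ((zz ^ j : (Matrix m m O)ˣ) : Matrix m m O) = algebraMap O _ ((z : O) ^ j) := by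
    intro j; rw [Units.val_pow_eq_pow_val, map_pow]; rfl
  have hcomm : Commute zz Y := by
    apply Units.ext
    rw [Units.val_mul, Units.val_mul]
    exact Algebra.commutes (z : O) (Y : Matrix m m O)
  have hZ : ∀ j : ℕ, (((zz * Y) ^ j : (Matrix m m O)ˣ) : Matrix m m O) = (z : O) ^ j • ((Y ^ j : (Matrix m m O)ˣ) : Matrix m m O) := by
    intro j
    rw [hcomm.mul_pow, Units.val_mul, hzz, Algebra.smul_def]
  have hzzq : zz ^ q = 1 := by
    apply Units.ext; rw [hzz, ← Units.val_pow_eq_pow_val, hz]; simp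
  have h1 := aux_idem q Y hY e s he heY hs _ rfl
  have h2 := aux_idem q (zz * Y) (by rw [hcomm.mul_pow, hzzq, hY, one_mul]) e s he
    (by
      rw [Units.val_mul]
      exact Commute.mul_right (Algebra.commutes (z : O) e).symm heY)
    (by
      rw [← hs]
      refine Finset.sum_congr rfl fun j _ => ?_
      have hc : Commute (zz ^ j) (Y ^ j) := hcomm.pow_pow j j
      have : (((zz * Y) ^ j)⁻¹ : (Matrix m m O)ˣ) = (zz ^ j)⁻¹ * (Y ^ j)⁻¹ := by
        rw [hcomm.mul_pow, hc.eq, mul_inv_rev]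
      rw [this, hcomm.mul_pow, hc.eq, Units.val_mul, Units.val_mul]
      have h5 : ((zz ^ j : (Matrix m m O)ˣ) : Matrix m m O) * s = s * ((zz ^ j : (Matrix m m O)ˣ) : Matrix m m O) := by
        rw [hzz]; exact Algebra.commutes _ _
      rw [mul_assoc _ _ s, h5, ← mul_assoc, ← mul_assoc, mul_assoc _ _ ((zz ^ j)⁻¹ : (Matrix m m O)ˣ).val, Units.mul_inv, mul_one]) _ rfl
  have h3 := aux_trace_eq _ _ h2.1 h1.1 (by
    intro i j
    rw [← Matrix.sub_apply, ← sub_mul, ← Finset.sum_sub_distrib, Matrix.mul_apply]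
    refine Ideal.sum_mem _ fun k _ => Ideal.mul_mem_right _ _ ?_
    rw [Matrix.sum_apply]
    refine Ideal.sum_mem _ fun l _ => ?_
    rw [hZ, Matrix.sub_apply, Matrix.smul_apply, smul_eq_mul, ← sub_one_mul]
    refine Ideal.mul_mem_right _ _ ?_
    exact Ideal.mem_of_dvd _ (by simpa using sub_dvd_pow_sub_pow (z : O) 1 l) hz1)
  rw [← h1.2, ← h3, h2.2]
  refine Finset.sum_congr rfl fun j _ => ?_
  rw [hZ, mul_smul_comm, Matrix.trace_smul, smul_eq_mul]
end

section
open Matrix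
variable {O : Type*} [CommRing O] {G : Type*} [Group G] [Fintype G] [DecidableEq G]

theorem aux_lmm (a : MonoidAlgebra O G) (g h : G) :
    Algebra.leftMulMatrix (MonoidAlgebra.basis G O) a g h = a.coeff (g * h⁻¹) := by
  rw [Algebra.leftMulMatrix_eq_repr_mul, MonoidAlgebra.basis_apply]
  have : (MonoidAlgebra.basis G O).repr (a * MonoidAlgebra.single h 1) g = (a * MonoidAlgebra.single h 1).coeff g := rfl
  rw [this, MonoidAlgebra.coeff_mul_single_apply, mul_one]

theorem aux_trace (a : MonoidAlgebra O G) :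
    (Algebra.leftMulMatrix (MonoidAlgebra.basis G O) a).trace = Fintype.card G * a.coeff 1 := by
  simp [Matrix.trace, aux_lmm]

theorem aux_transversal (y : G) : ∃ t : G → O, ∀ g, ∑ j ∈ Finset.range (orderOf y), t ((y ^ j)⁻¹ * g) = 1 := by
  classical
  obtain ⟨T, hT, -⟩ := Subgroup.exists_isComplement_right (Subgroup.zpowers y) 1
  refine ⟨fun g => if g ∈ T then 1 else 0, fun g => ?_⟩
  have hu : ∃! j, j ∈ Finset.range (orderOf y) ∧ (y ^ j)⁻¹ * g ∈ T := by
    obtain ⟨⟨⟨h, hh⟩, ⟨t, ht⟩⟩, hht⟩ := hT.2 g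
    have hht : h * t = g := hht
    have hh2 : h ∈ (Subgroup.zpowers y) := hh
    rw [← mem_powers_iff_mem_zpowers, mem_powers_iff_mem_range_orderOf] at hh2
    obtain ⟨j, hj, hjh⟩ := Finset.mem_image.1 hh2
    refine ⟨j, ⟨hj, ?_⟩, ?_⟩
    · rw [hjh, ← hht, inv_mul_cancel_left]; exact ht
    · rintro k ⟨hk, hkT⟩
      have hinj := hT.1 (a₁ := (⟨y ^ k, Subgroup.pow_mem _ (Subgroup.mem_zpowers y) k⟩, ⟨_, hkT⟩)) (a₂ := (⟨h, hh⟩, ⟨t, ht⟩))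
        (by simp [hht])
      have h2 : y ^ k = h := by
        have := congrArg (fun w => (w.1 : G)) hinj
        exact this
      rw [← hjh] at h2
      exact pow_injOn_Iio_orderOf (Finset.mem_range.1 hk) (Finset.mem_range.1 hj) h2
  obtain ⟨j, ⟨hj, hjT⟩, huj⟩ := hu
  rw [Finset.sum_eq_single_of_mem j hj]
  · simp [hjT]
  · intro k hk hkj
    refine if_neg ?_
    intro hkT
    exact hkj (huj k ⟨hk, hkT⟩)

theorem aux_group [IsLocalRing O] (y : G) (e : MonoidAlgebra O G) (he : e * e = e)
    (hey : Commute e (MonoidAlgebra.single y 1))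
    (z : Oˣ) (hz : z ^ (orderOf y) = 1) (hz1 : (z : O) - 1 ∈ IsLocalRing.maximalIdeal O) :
    ∑ j ∈ Finset.range (orderOf y), (z : O) ^ j * (Fintype.card G * (e * MonoidAlgebra.single (y ^ j) 1).coeff 1) =
    ∑ j ∈ Finset.range (orderOf y), (Fintype.card G : O) * (e * MonoidAlgebra.single (y ^ j) 1).coeff 1 := by
  let L := Algebra.leftMulMatrix (MonoidAlgebra.basis G O)
  let ψ : G →* Matrix G G O := (L : MonoidAlgebra O G →* Matrix G G O).comp (MonoidAlgebra.of O G)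
  let Y : (Matrix G G O)ˣ := Units.map ψ (toUnits y)
  have hYj : ∀ j : ℕ, ((Y ^ j : (Matrix G G O)ˣ) : Matrix G G O) = L (MonoidAlgebra.single (y ^ j) 1) := by
    intro j
    have : Y ^ j = Units.map ψ (toUnits (y ^ j)) := by rw [map_pow, map_pow]
    rw [this]; rfl
  have hYj' : ∀ j : ℕ, (((Y ^ j)⁻¹ : (Matrix G G O)ˣ) : Matrix G G O) = L (MonoidAlgebra.single (y ^ j)⁻¹ 1) := by
    intro j
    have : (Y ^ j)⁻¹ = Units.map ψ (toUnits (y ^ j)⁻¹) := by rw [map_inv, map_inv, map_pow, map_pow]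
    rw [this]; rfl
  obtain ⟨t, ht⟩ := aux_transversal (O := O) y
  have key := aux_zeta (orderOf y) Y
    (by rw [← map_pow, ← map_pow, pow_orderOf_eq_one, map_one, map_one]) (L e) (Matrix.diagonal t)
    (by rw [← map_mul, he])
    (by
      have := hYj 1
      rw [pow_one, pow_one] at this
      rw [this]
      exact hey.map L)
    (by
      ext g h
      rw [Matrix.sum_apply]
      have : ∀ j : ℕ, (((Y ^ j : (Matrix G G O)ˣ) : Matrix G G O) * Matrix.diagonal t * ((Y ^ j)⁻¹ : (Matrix G G O)ˣ)) g h
          = if g = h then t ((y ^ j)⁻¹ * g) else 0 := by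
        intro j
        rw [hYj, hYj', Matrix.mul_apply, Finset.sum_eq_single ((y ^ j)⁻¹ * g)]
        · rw [Matrix.mul_diagonal, aux_lmm, aux_lmm]
          simp only [MonoidAlgebra.coeff_single, Finsupp.single_apply]
          by_cases hgh : g = h
          · simp [hgh]
          · have : ¬ ((y ^ j)⁻¹ = (y ^ j)⁻¹ * g * h⁻¹) := by
              rw [mul_assoc, left_eq_mul, mul_inv_eq_one]; exact hgh
            simp [hgh, this]
        · intro k _ hk
          rw [Matrix.mul_diagonal, aux_lmm]
          simp only [MonoidAlgebra.coeff_single, Finsupp.single_apply]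
          rw [if_neg]
          · simp
          · intro h1
            apply hk
            rw [h1]; group
        · simp
      rw [Finset.sum_congr rfl fun j _ => this j]
      by_cases hgh : g = h
      · subst hgh
        simp only [if_true, ht, Matrix.one_apply_eq]
      · simp [hgh]) z hz hz1
  simp only [hYj, ← map_mul] at key
  simpa only [L, aux_trace] using key
end

theorem aux_roots {ι : Type*} [Fintype ι] [Nonempty ι] (f : ι → ℂ) (N : ℕ) (hN : N ≠ 0) (hf : ∀ i, f i ^ N = 1)
    (hInt : IsIntegral ℤ ((∑ i, f i) / Fintype.card ι)) (h0 : ∑ i, f i ≠ 0) :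
    ∃ α : ℂ, ∀ i, f i = α := by
  have hd : (Fintype.card ι : ℂ) ≠ 0 := by exact_mod_cast Fintype.card_ne_zero
  set α := (∑ i, f i) / Fintype.card ι with hα
  have hα0 : α ≠ 0 := div_ne_zero h0 hd
  let K := IntermediateField.adjoin ℚ (Set.range f)
  have hfK : ∀ i, f i ∈ K := fun i => IntermediateField.subset_adjoin _ _ ⟨i, rfl⟩
  have : FiniteDimensional ℚ K := by
    apply IntermediateField.finiteDimensional_adjoin
    rintro _ ⟨i, rfl⟩
    refine IsIntegral.of_pow (Nat.pos_of_ne_zero hN) ?_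
    rw [hf i]; exact isIntegral_one
  have : NumberField K := { to_charZero := inferInstance, to_finiteDimensional := this }
  let F : ι → K := fun i => ⟨f i, hfK i⟩
  let a : K := (∑ i, F i) / Fintype.card ι
  have ha : algebraMap K ℂ a = α := by
    simp only [a, map_div₀, map_sum, map_natCast]; rfl
  have hF : ∀ i, F i ^ N = 1 := fun i => Subtype.ext (hf i)
  have hnorm : ‖α‖ = 1 := by
    obtain ⟨n, hn, han⟩ := NumberField.Embeddings.pow_eq_one_of_norm_le_one K ℂ (x := a)
      (by intro h; apply hα0; rw [← ha, h, map_zero])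
      (by
        rw [← isIntegral_algebraMap_iff (algebraMap K ℂ).injective, ha]; exact hInt)
      (by
        intro φ
        simp only [a, map_div₀, map_sum, map_natCast]
        rw [norm_div, Complex.norm_natCast, div_le_one (by exact_mod_cast Fintype.card_pos)]
        refine (norm_sum_le _ _).trans ?_
        have : ∀ i, ‖φ (F i)‖ = 1 := fun i => by
          refine Complex.norm_eq_one_of_pow_eq_one (n := N) ?_ hN
          rw [← map_pow, hF, map_one]
        simp [this])
    refine Complex.norm_eq_one_of_pow_eq_one (n := n) ?_ hn.ne'
    rw [← ha, ← map_pow, han, map_one]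
  refine ⟨α, ?_⟩
  have hfn : ∀ i, ‖f i‖ = 1 := fun i => Complex.norm_eq_one_of_pow_eq_one (hf i) hN
  have hnn : ∀ i ∈ Finset.univ, 0 ≤ 1 - ((starRingEnd ℂ) α * f i).re := by
    intro i _
    have := Complex.re_le_norm ((starRingEnd ℂ) α * f i)
    rw [norm_mul, RCLike.norm_conj, hnorm, hfn] at this
    linarith
  have hsum : ∑ i, (1 - ((starRingEnd ℂ) α * f i).re) = 0 := by
    rw [Finset.sum_sub_distrib, ← Complex.re_sum, ← Finset.mul_sum]
    have : ∑ i, f i = α * Fintype.card ι := by rw [hα, div_mul_cancel₀ _ hd]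
    rw [this, ← mul_assoc, mul_comm _ α, Complex.mul_conj, Complex.normSq_eq_norm_sq, hnorm]
    simp
  have hz := (Finset.sum_eq_zero_iff_of_nonneg hnn).1 hsum
  intro i
  have hi := hz i (Finset.mem_univ i)
  have h1 : ((starRingEnd ℂ) α * f i) = 1 := by
    have hn1 : ‖(starRingEnd ℂ) α * f i‖ = 1 := by rw [norm_mul, RCLike.norm_conj, hnorm, hfn, one_mul]
    have hre : ((starRingEnd ℂ) α * f i).re = 1 := by linarith
    have hsq := Complex.sq_norm_sub_sq_re ((starRingEnd ℂ) α * f i)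
    rw [hn1, hre] at hsq
    apply Complex.ext
    · simpa using hre
    · have : ((starRingEnd ℂ) α * f i).im ^ 2 = 0 := by linarith
      simpa using this
  have h2 : α * (starRingEnd ℂ) α = 1 := by
    rw [Complex.mul_conj, Complex.normSq_eq_norm_sq, hnorm]; simp
  calc f i = (α * (starRingEnd ℂ) α) * f i := by rw [h2, one_mul]
    _ = α := by rw [mul_assoc, h1, mul_one]

section
variable {d : ℕ} (M : Matrix (Fin d) (Fin d) ℂ) (N : ℕ)

theorem aux_root_pow [NeZero d] (hM : M ^ N = 1) (r : ℂ) (hr : r ∈ M.charpoly.roots) : r ^ N = 1 := by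
  have h1 : r ∈ spectrum ℂ M := by
    rw [Matrix.mem_spectrum_iff_isRoot_charpoly]
    exact (Polynomial.mem_roots'.1 hr).2
  have h2 := spectrum.pow_mem_pow M N h1
  rw [hM, spectrum.one_eq] at h2
  exact h2

theorem aux_trace_int [NeZero d] (hN : N ≠ 0) (hM : M ^ N = 1) : IsIntegral ℤ M.trace := by
  rw [Matrix.trace_eq_sum_roots_charpoly]
  refine IsIntegral.multiset_sum ?_
  intro r hr
  refine IsIntegral.of_pow (Nat.pos_of_ne_zero hN) ?_
  rw [aux_root_pow M N hM r hr]; exact isIntegral_one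

theorem aux_scalar [NeZero d] (hN : N ≠ 0) (hM : M ^ N = 1) (hInt : IsIntegral ℤ (M.trace / d)) (h0 : M.trace ≠ 0) :
    ∃ α : ℂ, M = algebraMap ℂ _ α := by
  have hs : M.charpoly.Splits := IsAlgClosed.splits _
  have hcard : M.charpoly.roots.card = d := by
    rw [← hs.natDegree_eq_card_roots, Matrix.charpoly_natDegree_eq_dim, Fintype.card_fin]
  set l := M.charpoly.roots.toList with hl
  have hlen : l.length = d := by rw [hl, Multiset.length_toList, hcard]
  have hsum : M.trace = ∑ i : Fin l.length, l.get i := by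
    rw [Matrix.trace_eq_sum_roots_charpoly, ← Multiset.sum_toList, ← hl, ← List.sum_ofFn, List.ofFn_get]
  have : Nonempty (Fin l.length) := by rw [hlen]; exact ⟨0⟩
  have hmem : ∀ i : Fin l.length, l.get i ∈ M.charpoly.roots := fun i => by
    rw [← Multiset.mem_toList]; exact List.get_mem _ _
  obtain ⟨α, hα⟩ := aux_roots (fun i : Fin l.length => l.get i) N hN
    (fun i => aux_root_pow M N hM _ (hmem i))
    (by rw [← hsum, Fintype.card_fin, hlen]; exact hInt) (by rw [← hsum]; exact h0)
  refine ⟨α, ?_⟩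
  have hrep : M.charpoly.roots = Multiset.replicate d α := by
    rw [Multiset.eq_replicate]
    refine ⟨hcard, fun b hb => ?_⟩
    rw [← Multiset.mem_toList, ← hl] at hb
    obtain ⟨i, rfl⟩ := List.get_of_mem hb
    exact hα i
  have hcp : M.charpoly = (Polynomial.X - Polynomial.C α) ^ d := by
    rw [hs.eq_prod_roots_of_monic (Matrix.charpoly_monic M), hrep]; simp
  have hsq : Squarefree (Polynomial.X ^ N - 1 : Polynomial ℂ) :=
    (Polynomial.separable_X_pow_sub_C (1 : ℂ) (by exact_mod_cast hN) one_ne_zero).squarefree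
  have hdvd1 : minpoly ℂ M ∣ (Polynomial.X ^ N - 1 : Polynomial ℂ) := minpoly.dvd _ _ (by simp [hM])
  have hdvd2 : minpoly ℂ M ∣ (Polynomial.X - Polynomial.C α) ^ d := by
    rw [← hcp]; exact Matrix.minpoly_dvd_charpoly M
  have hdvd3 := ((hsq.squarefree_of_dvd hdvd1).dvd_pow_iff_dvd (NeZero.ne d)).1 hdvd2
  have := Polynomial.aeval_eq_zero_of_dvd_aeval_eq_zero hdvd3 (minpoly.aeval ℂ M)
  simpa [sub_eq_zero] using this
end

section
variable {G : Type*} [Group G] [Fintype G] [DecidableEq G] {r : ℕ} {d : Fin r → ℕ} [∀ i, NeZero (d i)]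
  (Φ : MonoidAlgebra ℂ G ≃ₐ[ℂ] Π i, Matrix (Fin (d i)) (Fin (d i)) ℂ)

theorem aux_wtrace (a : MonoidAlgebra ℂ G) :
    (Fintype.card G : ℂ) * a.coeff 1 = ∑ i, (d i : ℂ) * (Φ a i).trace := by
  let b := Pi.basis (fun i => Matrix.stdBasis ℂ (Fin (d i)) (Fin (d i)))
  have h1 : (Algebra.leftMulMatrix (MonoidAlgebra.basis G ℂ) a).trace = LinearMap.trace ℂ _ (LinearMap.mulLeft ℂ a) :=
    (LinearMap.trace_eq_matrix_trace ℂ (MonoidAlgebra.basis G ℂ) _).symm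
  have h2 : (Algebra.leftMulMatrix b (Φ a)).trace = LinearMap.trace ℂ _ (LinearMap.mulLeft ℂ (Φ a)) :=
    (LinearMap.trace_eq_matrix_trace ℂ b _).symm
  have h3 : LinearMap.mulLeft ℂ (Φ a) = Φ.toLinearEquiv.conj (LinearMap.mulLeft ℂ a) := by
    refine LinearMap.ext fun v => ?_
    simp [LinearEquiv.conj_apply]
  rw [← aux_trace, h1, ← LinearMap.trace_conj' _ Φ.toLinearEquiv, ← h3, ← h2, Matrix.trace, Fintype.sum_sigma]
  refine Finset.sum_congr rfl fun i _ => ?_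
  rw [Fintype.sum_prod_type]
  simp only [Matrix.diag_apply, Algebra.leftMulMatrix_eq_repr_mul, b, Pi.basis_repr, Pi.basis_apply,
    Pi.mul_apply, Pi.single_eq_same, Matrix.stdBasis_eq_single]
  have : ∀ (M : Matrix (Fin (d i)) (Fin (d i)) ℂ) (x y : Fin (d i)),
      (Matrix.stdBasis ℂ (Fin (d i)) (Fin (d i))).repr M (x, y) = M x y := fun M x y => rfl
  simp [this, Matrix.trace, Finset.mul_sum]

theorem aux_span (a : MonoidAlgebra ℂ G) (P : MonoidAlgebra ℂ G → Prop) (h1 : ∀ g, P (MonoidAlgebra.single g 1))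
    (h2 : ∀ a b, P a → P b → P (a + b)) (h3 : ∀ (c : ℂ) a, P a → P (c • a)) : P a :=
  MonoidAlgebra.induction_on a (fun g => h1 g) h2 h3

theorem aux_central (a : MonoidAlgebra ℂ G) (ha : ∀ g : G, Commute a (MonoidAlgebra.single g 1)) (i : Fin r) :
    ∃ c : ℂ, Φ a i = algebraMap ℂ _ c := by
  have hall : ∀ b, Commute a b := fun b => aux_span b (fun b => Commute a b) ha
    (fun _ _ h h' => h.add_right h') (fun c _ h => h.smul_right c)
  have : Φ a i ∈ Set.range (Matrix.scalar (Fin (d i))) := by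
    rw [Matrix.mem_range_scalar_iff_commute_single']
    intro j k
    have := (hall (Φ.symm (Pi.single i (Matrix.single j k 1)))).map Φ
    rw [AlgEquiv.apply_symm_apply] at this
    have h2 := congrFun this.eq i
    simp only [Pi.mul_apply, Pi.single_eq_same] at h2
    exact h2.symm
  obtain ⟨c, hc⟩ := this
  exact ⟨c, hc.symm⟩

theorem aux_dim_one (i : Fin r) (h : ∀ g : G, ∃ c : ℂ, Φ (MonoidAlgebra.single g 1) i = algebraMap ℂ _ c) :
    d i = 1 := by
  have hall : ∀ b, ∃ c : ℂ, Φ b i = algebraMap ℂ _ c := fun b =>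
    aux_span b (fun b => ∃ c : ℂ, Φ b i = algebraMap ℂ _ c) h
    (fun a b ⟨c, hc⟩ ⟨c', hc'⟩ => ⟨c + c', by rw [map_add, Pi.add_apply, hc, hc', map_add]⟩)
    (fun k a ⟨c, hc⟩ => ⟨k * c, by rw [map_smul, Pi.smul_apply, hc, Algebra.smul_def, map_mul]⟩)
  by_contra hd
  have h2 : 2 ≤ d i := by have := NeZero.ne (d i); omega
  obtain ⟨c, hc⟩ := hall (Φ.symm (Pi.single i (Matrix.single ⟨0, by omega⟩ ⟨1, by omega⟩ 1)))
  rw [AlgEquiv.apply_symm_apply, Pi.single_eq_same] at hc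
  have := congrFun (congrFun hc ⟨0, by omega⟩) ⟨1, by omega⟩
  rw [Matrix.single_apply_same, Matrix.algebraMap_matrix_apply] at this
  simp at this

theorem aux_inj (i j : Fin r) (h : ∀ g : G, (Φ (MonoidAlgebra.single g 1) i).trace = (Φ (MonoidAlgebra.single g 1) j).trace) :
    i = j := by
  by_contra hij
  have hall : ∀ b, (Φ b i).trace = (Φ b j).trace := fun b =>
    aux_span b (fun b => (Φ b i).trace = (Φ b j).trace) h
    (fun a b ha hb => by simp [ha, hb])
    (fun k a ha => by simp [ha])
  have := hall (Φ.symm (Pi.single i 1))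
  rw [AlgEquiv.apply_symm_apply, Pi.single_eq_same, Pi.single_eq_of_ne (Ne.symm hij)] at this
  simp at this
  exact NeZero.ne (d i) this

theorem aux_exists (lam : G →* ℂ) : ∃ i, d i = 1 ∧ ∀ g, Φ (MonoidAlgebra.single g 1) i = algebraMap ℂ _ (lam g) := by
  let a : MonoidAlgebra ℂ G := ∑ g, MonoidAlgebra.single g (lam g⁻¹)
  have hl : ∀ g, lam g⁻¹ * lam g = 1 := fun g => by rw [← map_mul, inv_mul_cancel, map_one]
  have hleft : ∀ h, MonoidAlgebra.single h 1 * a = lam h • a := by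
    intro h
    simp only [a, Finset.mul_sum, Finset.smul_sum]
    refine Fintype.sum_equiv (Equiv.mulLeft h) _ _ fun g => ?_
    simp only [MonoidAlgebra.single_mul_single, MonoidAlgebra.smul_single, Equiv.coe_mulLeft, one_mul, smul_eq_mul]
    rw [mul_inv_rev, map_mul, mul_comm, mul_assoc, hl, mul_one]
  have hright : ∀ h, a * MonoidAlgebra.single h 1 = lam h • a := by
    intro h
    simp only [a, Finset.sum_mul, Finset.smul_sum]
    refine Fintype.sum_equiv (Equiv.mulRight h) _ _ fun g => ?_
    simp only [MonoidAlgebra.single_mul_single, MonoidAlgebra.smul_single, Equiv.coe_mulRight, mul_one, smul_eq_mul]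
    rw [mul_inv_rev, map_mul, ← mul_assoc, mul_comm (lam h), hl, one_mul]
  have ha1 : a.coeff 1 = 1 := by
    simp only [a, MonoidAlgebra.coeff_sum, Finsupp.finsetSum_apply, MonoidAlgebra.coeff_single]
    rw [Finset.sum_eq_single 1]
    · simp
    · intro b _ hb; simp [Finsupp.single_apply, hb]
    · simp
  have hex : ∃ i, Φ a i ≠ 0 := by
    by_contra! hcon
    have := aux_wtrace Φ a
    rw [ha1] at this
    simp [hcon] at this
  obtain ⟨i, hi⟩ := hex
  obtain ⟨c, hc⟩ := aux_central Φ a (fun g => by rw [Commute, SemiconjBy, hleft, hright]) i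
  have hc0 : c ≠ 0 := by rintro rfl; apply hi; rw [hc, map_zero]
  have hsc : ∀ g, Φ (MonoidAlgebra.single g 1) i = algebraMap ℂ _ (lam g) := by
    intro g
    have := congrFun (congrArg Φ (hleft g)) i
    rw [map_mul, map_smul, Pi.mul_apply, Pi.smul_apply, hc, ← Algebra.commutes, ← Algebra.smul_def, Algebra.smul_def (lam g),
      ← Algebra.commutes, ← Algebra.smul_def] at this
    exact smul_right_injective _ hc0 this
  exact ⟨i, aux_dim_one Φ i fun g => ⟨_, hsc g⟩, hsc⟩
end

theorem aux_dvd (k m : ℕ) (β : ℂ) (hβ : IsIntegral ℤ β) (h : (m : ℂ) = k * β) : k ∣ m := by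
  rcases Nat.eq_zero_or_pos k with rfl | hk
  · have : (m : ℂ) = 0 := by simpa using h
    have : m = 0 := by exact_mod_cast this
    simp [this]
  have hk' : (k : ℂ) ≠ 0 := by exact_mod_cast hk.ne'
  have h2 : β = algebraMap ℚ ℂ ((m : ℚ) / k) := by
    rw [map_div₀, map_natCast, map_natCast, h]; field_simp
  rw [h2, isIntegral_algebraMap_iff (algebraMap ℚ ℂ).injective] at hβ
  obtain ⟨t, ht⟩ := IsIntegrallyClosed.isIntegral_iff.1 hβ
  have hk'' : (k : ℚ) ≠ 0 := by exact_mod_cast hk.ne'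
  have h3 : (m : ℚ) = k * t := by
    have : (t : ℚ) = m / k := by simpa using ht
    rw [this]; field_simp
  have h4 : (m : ℤ) = k * t := by exact_mod_cast h3
  exact Int.natCast_dvd_natCast.1 ⟨t, h4⟩

theorem aux_val (q : ℕ) (hq : q.Prime) : ∃ O : ValuationSubring ℂ, (∀ β : ℂ, IsIntegral ℤ β → β ∈ O) ∧
    O.valuation (q : ℂ) < 1 := by
  let A : Subring ℂ := (integralClosure ℤ ℂ).toSubring
  let I : Ideal A := Ideal.span {(q : A)}
  have hI : I ≠ ⊤ := by
    intro h
    rw [Ideal.eq_top_iff_one, Ideal.mem_span_singleton] at h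
    obtain ⟨b, hb⟩ := h
    have h1 : ((1 : ℕ) : ℂ) = q * (b : ℂ) := by
      have := congrArg (fun w : A => (w : ℂ)) hb
      simpa using this
    have := aux_dvd q 1 b b.2 h1
    exact hq.one_lt.ne' (Nat.dvd_one.1 this)
  obtain ⟨B, hB, hBI⟩ := Ideal.image_subset_nonunits_valuationSubring I hI
  refine ⟨B, fun β hβ => hB hβ, ?_⟩
  have : (q : ℂ) ∈ B.nonunits := hBI ⟨(q : A), Ideal.mem_span_singleton_self _, by simp⟩
  exact (ValuationSubring.mem_nonunits_iff B).1 this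

section
variable {G : Type*} [Group G] [Fintype G] [DecidableEq G] {r : ℕ} {d : Fin r → ℕ} [∀ i, NeZero (d i)]
  (Φ : MonoidAlgebra ℂ G ≃ₐ[ℂ] Π i, Matrix (Fin (d i)) (Fin (d i)) ℂ)

/-- The `i`-th representation. -/
noncomputable def auxRho (i : Fin r) : G →* Matrix (Fin (d i)) (Fin (d i)) ℂ where
  toFun g := Φ (MonoidAlgebra.single g 1) i
  map_one' := by
    rw [← MonoidAlgebra.one_def, map_one]; rfl
  map_mul' a b := by
    rw [← Pi.mul_apply, ← map_mul, MonoidAlgebra.single_mul_single, one_mul]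

theorem aux_lin (i : Fin r) (hi : d i = 1) : ∃ lam : G →* ℂˣ, ∀ g, auxRho Φ i g = algebraMap ℂ _ (lam g : ℂ) := by
  refine ⟨((Matrix.detMonoidHom).comp (auxRho Φ i)).toHomUnits, fun g => ?_⟩
  have : ∀ (k : ℕ) (hk : k = 1) (M : Matrix (Fin k) (Fin k) ℂ), M = algebraMap ℂ _ M.det := by
    rintro k rfl M
    ext a b
    fin_cases a; fin_cases b
    simp [Matrix.algebraMap_matrix_apply]
  exact this _ hi _

theorem aux_rho_pow (i : Fin r) (g : G) : auxRho Φ i g ^ Fintype.card G = 1 := by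
  rw [← map_pow, pow_card_eq_one, map_one]

theorem aux_tr_int (i : Fin r) (g : G) : IsIntegral ℤ (auxRho Φ i g).trace :=
  aux_trace_int _ _ Fintype.card_ne_zero (aux_rho_pow Φ i g)

theorem aux_scal_all (x : G) (hgen : Subgroup.closure (conjugatesOf x) = ⊤) (i : Fin r) (α : ℂ)
    (hα : auxRho Φ i x = algebraMap ℂ _ α) : d i = 1 := by
  apply aux_dim_one Φ i
  intro g
  change ∃ c : ℂ, auxRho Φ i g = algebraMap ℂ _ c
  have hα' : ∀ c ∈ conjugatesOf x, auxRho Φ i c = algebraMap ℂ _ α := by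
    intro c hc
    obtain ⟨h, rfl⟩ := isConj_iff.1 (show IsConj x _ from hc)
    rw [map_mul, map_mul, hα, ← Algebra.commutes, mul_assoc, ← map_mul, mul_inv_cancel, map_one, mul_one]
  have hg : g ∈ Subgroup.closure (conjugatesOf x) := by rw [hgen]; trivial
  rw [← Subgroup.mem_toSubmonoid, Subgroup.closure_toSubmonoid_of_finite] at hg
  induction hg using Submonoid.closure_induction with
  | mem c hc => exact ⟨α, hα' c hc⟩
  | one => exact ⟨1, by rw [map_one, map_one]⟩
  | mul a b _ _ ha hb =>
    obtain ⟨c, hc⟩ := ha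
    obtain ⟨c', hc'⟩ := hb
    exact ⟨c * c', by rw [map_mul, hc, hc', map_mul]⟩

/-- class sum -/
noncomputable def auxK (R : Type*) [CommRing R] (x : G) : MonoidAlgebra R G :=
  ∑ c ∈ (Set.toFinite (conjugatesOf x)).toFinset, MonoidAlgebra.single c 1

theorem auxK_map {R S : Type*} [CommRing R] [CommRing S] (f : R →+* S) (x : G) :
    MonoidAlgebra.mapRingHom G f (auxK R x) = auxK S x := by
  simp [auxK]

theorem auxK_comm (x g : G) : Commute (auxK ℂ x) (MonoidAlgebra.single g 1) := by
  rw [Commute, SemiconjBy, auxK, Finset.sum_mul, Finset.mul_sum]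
  refine Finset.sum_bij' (fun c _ => g⁻¹ * c * g) (fun c _ => g * c * g⁻¹) ?_ ?_ ?_ ?_ ?_
  · intro c hc
    rw [Set.Finite.mem_toFinset] at hc ⊢
    change IsConj x _ at hc
    change IsConj x _
    exact hc.trans (isConj_iff.2 ⟨g⁻¹, by group⟩)
  · intro c hc
    rw [Set.Finite.mem_toFinset] at hc ⊢
    change IsConj x _ at hc
    change IsConj x _
    exact hc.trans (isConj_iff.2 ⟨g, by group⟩)
  · intro c _; group
  · intro c _; group
  · intro c _
    simp only [MonoidAlgebra.single_mul_single, one_mul]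
    congr 1; group

theorem aux_omega (x : G) (i : Fin r) : ∃ w : ℂ, IsIntegral ℤ w ∧ Φ (auxK ℂ x) i = algebraMap ℂ _ w ∧
    (d i : ℂ) * w = (Nat.card (conjugatesOf x) : ℂ) * (auxRho Φ i x).trace := by
  obtain ⟨w, hw⟩ := aux_central Φ (auxK ℂ x) (auxK_comm x) i
  refine ⟨w, ?_, hw, ?_⟩
  · have h1 : IsIntegral ℤ (auxK ℤ x) := IsIntegral.of_finite ℤ _
    let F : MonoidAlgebra ℤ G →+* Matrix (Fin (d i)) (Fin (d i)) ℂ :=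
      (Pi.evalRingHom (fun i => Matrix (Fin (d i)) (Fin (d i)) ℂ) i).comp ((Φ : MonoidAlgebra ℂ G →+* Π i, Matrix (Fin (d i)) (Fin (d i)) ℂ).comp (MonoidAlgebra.mapRingHom G (Int.castRingHom ℂ)))
    have h2 := h1.map F.toIntAlgHom
    have h3 : F.toIntAlgHom (auxK ℤ x) = algebraMap ℂ _ w := by
      rw [← hw]
      change Φ (MonoidAlgebra.mapRingHom G (Int.castRingHom ℂ) (auxK ℤ x)) i = _
      rw [auxK_map]
    rw [h3] at h2
    exact (isIntegral_algebraMap_iff (algebraMap ℂ (Matrix (Fin (d i)) (Fin (d i)) ℂ)).injective).1 h2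
  · have h1 : (Φ (auxK ℂ x) i).trace = (d i : ℂ) * w := by
      rw [hw, Matrix.trace]
      simp [Matrix.algebraMap_matrix_apply]
    rw [← h1, auxK, map_sum, Finset.sum_apply, Matrix.trace_sum]
    have : ∀ c ∈ (Set.toFinite (conjugatesOf x)).toFinset, (Φ (MonoidAlgebra.single c 1) i).trace = (auxRho Φ i x).trace := by
      intro c hc
      rw [Set.Finite.mem_toFinset] at hc
      obtain ⟨h, rfl⟩ := isConj_iff.1 (show IsConj x _ from hc)
      change (auxRho Φ i _).trace = _
      rw [map_mul, Matrix.trace_mul_comm, ← map_mul, inv_mul_cancel_left]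
    rw [Finset.sum_congr rfl this, Finset.sum_const, nsmul_eq_mul, Nat.card_coe_set_eq, Set.ncard_eq_toFinset_card _ (Set.toFinite _)]
end

theorem aux_one_le_val (O : ValuationSubring ℂ) (p q : ℕ) (hpq : Nat.Coprime p q)
    (hq : O.valuation (q : ℂ) < 1) : O.valuation (p : ℂ) = 1 := by
  have hle : ∀ k : ℤ, O.valuation (k : ℂ) ≤ 1 := fun k => (O.valuation_le_one_iff _).2 (intCast_mem O k)
  refine le_antisymm (by simpa using hle p) ?_
  by_contra hlt
  rw [not_le] at hlt
  have h := Nat.gcd_eq_gcd_ab p q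
  rw [hpq] at h
  have h1 : (1 : ℂ) = (p : ℂ) * (Nat.gcdA p q : ℂ) + (q : ℂ) * (Nat.gcdB p q : ℂ) := by exact_mod_cast h
  have h2 : O.valuation (1 : ℂ) < 1 := by
    rw [h1]
    refine Valuation.map_add_lt _ ?_ ?_
    · rw [map_mul]; exact mul_lt_one_of_lt_of_le hlt (hle _)
    · rw [map_mul]; exact mul_lt_one_of_lt_of_le hq (hle _)
  rw [map_one] at h2
  exact lt_irrefl _ h2

section
variable {G : Type*} [Group G] [Fintype G] [DecidableEq G] {r : ℕ} {d : Fin r → ℕ} [∀ i, NeZero (d i)]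
  (Φ : MonoidAlgebra ℂ G ≃ₐ[ℂ] Π i, Matrix (Fin (d i)) (Fin (d i)) ℂ)

theorem aux_Sdim (x : G) (hgen : Subgroup.closure (conjugatesOf x) = ⊤) (p n : ℕ) (hp : p.Prime)
    (i : Fin r) (w : ℂ) (hw : IsIntegral ℤ w) (hw0 : w ≠ 0)
    (hdw : (d i : ℂ) * w = ((p ^ n : ℕ) : ℂ) * (auxRho Φ i x).trace) : d i = 1 ∨ p ∣ d i := by
  by_cases hpd : p ∣ d i
  · exact Or.inr hpd
  left
  have hd0 : (d i : ℂ) ≠ 0 := by exact_mod_cast NeZero.ne (d i)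
  have hcop : Nat.Coprime (d i) (p ^ n) := (Nat.Coprime.pow_left n ((Nat.Prime.coprime_iff_not_dvd hp).2 hpd)).symm
  have h := Nat.gcd_eq_gcd_ab (d i) (p ^ n)
  rw [hcop] at h
  have h1 : (1 : ℂ) = (d i : ℂ) * (Nat.gcdA (d i) (p ^ n) : ℂ) + ((p ^ n : ℕ) : ℂ) * (Nat.gcdB (d i) (p ^ n) : ℂ) := by
    exact_mod_cast h
  have ht : (auxRho Φ i x).trace / (d i : ℂ) = (Nat.gcdA (d i) (p ^ n) : ℂ) * (auxRho Φ i x).trace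
      + (Nat.gcdB (d i) (p ^ n) : ℂ) * w := by
    rw [div_eq_iff hd0]
    linear_combination (auxRho Φ i x).trace * h1 - (Nat.gcdB (d i) (p ^ n) : ℂ) * hdw
  have hInt : IsIntegral ℤ ((auxRho Φ i x).trace / (d i : ℂ)) := by
    rw [ht]
    exact ((isIntegral_algebraMap (R := ℤ) (A := ℂ)).mul (aux_tr_int Φ i x)).add
      ((isIntegral_algebraMap (R := ℤ) (A := ℂ)).mul hw)
  have htr : (auxRho Φ i x).trace ≠ 0 := by
    intro h0
    rw [h0, mul_zero] at hdw
    exact mul_ne_zero hd0 hw0 hdw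
  obtain ⟨α, hα⟩ := aux_scalar (auxRho Φ i x) _ Fintype.card_ne_zero (aux_rho_pow Φ i x) hInt htr
  exact aux_scal_all Φ x hgen i α hα

theorem aux_idem_exists (O : ValuationSubring ℂ) (x : G) (w : Fin r → O) (c : O)
    (hw : ∀ i, Φ (auxK ℂ x) i = algebraMap ℂ _ (w i : ℂ)) (S : Finset (Fin r))
    (hS : ∀ i, i ∈ S ↔ w i - c ∈ IsLocalRing.maximalIdeal O) :
    ∃ e : MonoidAlgebra O G, e * e = e ∧ (∀ g : G, Commute e (MonoidAlgebra.single g 1)) ∧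
      ∀ i, Φ (MonoidAlgebra.mapRingHom G O.subtype e) i = if i ∈ S then 1 else 0 := by
  classical
  let f : Polynomial O := ∏ i ∈ S, (Polynomial.X - Polynomial.C (w i))
  let g : Polynomial O := ∏ i ∈ Sᶜ, (Polynomial.X - Polynomial.C (w i))
  have hfg : IsCoprime f g := by
    refine IsCoprime.prod_left fun i hi => IsCoprime.prod_right fun j hj => ?_
    apply Polynomial.isCoprime_X_sub_C_of_isUnit_sub
    rw [Finset.mem_compl, hS] at hj
    rw [hS] at hi
    by_contra hn
    have hn' : w i - w j ∈ IsLocalRing.maximalIdeal O := hn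
    apply hj
    have := Ideal.sub_mem _ hi hn'
    simpa using this
  obtain ⟨u, v, huv⟩ := hfg
  have hinj : Function.Injective (fun a : MonoidAlgebra O G => Φ (MonoidAlgebra.mapRingHom G O.subtype a)) := by
    refine Φ.injective.comp ?_
    exact MonoidAlgebra.map_injective _ Subtype.val_injective
  have hE : ∀ i, Φ (MonoidAlgebra.mapRingHom G O.subtype (Polynomial.eval₂ (algebraMap O _) (auxK O x) (v * g))) i
      = if i ∈ S then 1 else 0 := by
    intro i
    let F : MonoidAlgebra O G →+* Matrix (Fin (d i)) (Fin (d i)) ℂ :=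
      (Pi.evalRingHom (fun i => Matrix (Fin (d i)) (Fin (d i)) ℂ) i).comp
        ((Φ : MonoidAlgebra ℂ G →+* Π i, Matrix (Fin (d i)) (Fin (d i)) ℂ).comp (MonoidAlgebra.mapRingHom G O.subtype))
    change F _ = _
    rw [Polynomial.hom_eval₂]
    have h1 : F.comp (algebraMap O (MonoidAlgebra O G)) =
        ((algebraMap ℂ (Matrix (Fin (d i)) (Fin (d i)) ℂ)).comp O.subtype).comp (RingHom.id O) := by
      ext1 a
      change Φ (MonoidAlgebra.mapRingHom G O.subtype (MonoidAlgebra.single 1 a)) i = algebraMap ℂ _ (a : ℂ)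
      rw [MonoidAlgebra.mapRingHom_single]
      have : (MonoidAlgebra.single (1 : G) (O.subtype a)) = algebraMap ℂ (MonoidAlgebra ℂ G) (a : ℂ) := rfl
      rw [this, AlgEquiv.commutes]
      rfl
    have h2 : F (auxK O x) = ((algebraMap ℂ (Matrix (Fin (d i)) (Fin (d i)) ℂ)).comp O.subtype) (w i) := by
      change Φ (MonoidAlgebra.mapRingHom G O.subtype (auxK O x)) i = _
      rw [auxK_map, hw]; rfl
    rw [h1, h2, ← Polynomial.hom_eval₂]
    have h3 : Polynomial.eval₂ (RingHom.id O) (w i) (v * g) = if i ∈ S then 1 else 0 := by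
      change Polynomial.eval (w i) (v * g) = _
      split_ifs with hi
      · have h0 : Polynomial.eval (w i) f = 0 := by
          rw [Polynomial.eval_prod]
          exact Finset.prod_eq_zero hi (by simp)
        have h4 := congrArg (Polynomial.eval (w i)) huv
        rw [Polynomial.eval_add, Polynomial.eval_mul, h0, mul_zero, zero_add, Polynomial.eval_one] at h4
        exact h4
      · have h0 : Polynomial.eval (w i) g = 0 := by
          rw [Polynomial.eval_prod]
          exact Finset.prod_eq_zero (Finset.mem_compl.2 hi) (by simp)
        rw [Polynomial.eval_mul, h0, mul_zero]
    rw [h3]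
    split_ifs <;> simp
  refine ⟨_, ?_, ?_, hE⟩
  · apply hinj
    funext i
    simp only [map_mul, Pi.mul_apply, hE]
    split_ifs <;> simp
  · intro y
    apply hinj
    funext i
    simp only [map_mul, Pi.mul_apply, hE]
    split_ifs <;> simp

theorem aux_count (O : ValuationSubring ℂ) (hO : ∀ β : ℂ, IsIntegral ℤ β → β ∈ O) (p q : ℕ) (hp : p.Prime)
    (hpq : Nat.Coprime p q) (hq : O.valuation (q : ℂ) < 1)
    (x : G) (hgen : Subgroup.closure (conjugatesOf x) = ⊤) :
    ¬ p ∣ Nat.card {i : Fin r // d i = 1 ∧ O.valuation ((auxRho Φ i x).trace - 1) < 1} := by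
  have hle : ∀ (l : G →* ℂˣ) (g : G), O.valuation (l g : ℂ) ≤ 1 := by
    intro l g
    apply (O.valuation_le_one_iff _).2
    apply hO
    refine IsIntegral.of_pow (n := Fintype.card G) Fintype.card_pos ?_
    rw [← Units.val_pow_eq_pow_val, ← map_pow, pow_card_eq_one, map_one]
    exact isIntegral_one
  let U : Subgroup (G →* ℂˣ) :=
    { carrier := {l | O.valuation ((l x : ℂ) - 1) < 1}
      one_mem' := by simp
      mul_mem' := by
        intro a b ha hb
        have : (((a * b) x : ℂˣ) : ℂ) - 1 = (a x : ℂ) * ((b x : ℂ) - 1) + ((a x : ℂ) - 1) := by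
          simp only [MonoidHom.mul_apply, Units.val_mul]; ring
        rw [Set.mem_ofPred_eq, this]
        refine Valuation.map_add_lt _ ?_ ha
        rw [map_mul, mul_comm]; exact mul_lt_one_of_lt_of_le hb (hle a x)
      inv_mem' := by
        intro a ha
        have : (((a⁻¹) x : ℂˣ) : ℂ) - 1 = - ((a⁻¹ x : ℂˣ) : ℂ) * ((a x : ℂ) - 1) := by
          rw [MonoidHom.inv_apply, mul_sub, neg_mul, Units.inv_mul]; ring
        rw [Set.mem_ofPred_eq, this, map_mul, Valuation.map_neg, mul_comm]
        exact mul_lt_one_of_lt_of_le ha (hle _ x) }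
  have htr : ∀ (k : ℕ) (hk : k = 1) (α : ℂ), (algebraMap ℂ (Matrix (Fin k) (Fin k) ℂ) α).trace = α := by
    rintro k rfl α
    simp [Matrix.trace, Matrix.algebraMap_matrix_apply]
  have hex : ∀ l : U, ∃ i : {i : Fin r // d i = 1 ∧ O.valuation ((auxRho Φ i x).trace - 1) < 1},
      ∀ g, (auxRho Φ i.1 g).trace = (l.1 g : ℂ) := by
    intro l
    obtain ⟨i, hi, h⟩ := aux_exists Φ ((Units.coeHom ℂ).comp l.1)
    have h' : ∀ g, (auxRho Φ i g).trace = (l.1 g : ℂ) := by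
      intro g
      change (Φ _ i).trace = _
      rw [h g, htr _ hi]; rfl
    refine ⟨⟨i, hi, ?_⟩, h'⟩
    rw [h']; exact l.2
  choose φ hφ using hex
  have hbij : Function.Bijective φ := by
    constructor
    · intro a b hab
      apply Subtype.ext
      ext g
      rw [← hφ, ← hφ, hab]
    · intro i
      obtain ⟨l, hl⟩ := aux_lin Φ i.1 i.2.1
      have hl' : ∀ g, (auxRho Φ i.1 g).trace = (l g : ℂ) := fun g => by rw [hl, htr _ i.2.1]
      refine ⟨⟨l, ?_⟩, ?_⟩
      · change O.valuation ((l x : ℂ) - 1) < 1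
        rw [← hl']; exact i.2.2
      · apply Subtype.ext
        apply aux_inj Φ
        intro g
        change (auxRho Φ _ g).trace = (auxRho Φ _ g).trace
        rw [hφ]; exact (hl' g).symm
  let E := Equiv.ofBijective φ hbij
  have : Finite U := Finite.of_equiv _ E.symm
  rw [← Nat.card_congr E]
  intro hdvd
  have := Fact.mk hp
  obtain ⟨l, hl⟩ := exists_prime_orderOf_dvd_card' p hdvd
  have hlp : l.1 ^ p = 1 := by
    have := pow_orderOf_eq_one l
    rw [hl] at this
    exact congrArg Subtype.val this
  have hl1 : l.1 ≠ 1 := by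
    intro h
    have : l = 1 := Subtype.ext h
    rw [this, orderOf_one] at hl
    exact hp.one_lt.ne hl
  have hx1 : l.1 x ≠ 1 := by
    intro h
    apply hl1
    have hk : Subgroup.closure (conjugatesOf x) ≤ l.1.ker := by
      rw [Subgroup.closure_le]
      intro c hc
      obtain ⟨k, rfl⟩ := isConj_iff.1 (show IsConj x _ from hc)
      rw [SetLike.mem_coe, MonoidHom.mem_ker, map_mul, map_mul, h, mul_one, ← map_mul, mul_inv_cancel, map_one]
    rw [hgen] at hk
    ext g
    rw [MonoidHom.mem_ker.1 (hk (Subgroup.mem_top g))]; rfl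
  set z : ℂ := (l.1 x : ℂ) with hz
  have hz1 : z ≠ 1 := fun h => hx1 (Units.ext h)
  have hzp : z ^ p = 1 := by
    rw [hz, ← Units.val_pow_eq_pow_val, ← MonoidHom.pow_apply, hlp]; simp
  have hsum : ∑ k ∈ Finset.range p, z ^ k = 0 := by
    have := geom_sum_mul z p
    rw [hzp, sub_self] at this
    exact (mul_eq_zero.1 this).resolve_right (sub_ne_zero.2 hz1)
  have hp1 : O.valuation (p : ℂ) < 1 := by
    have h1 : (p : ℂ) = ∑ k ∈ Finset.range p, (1 - z ^ k) := by
      rw [Finset.sum_sub_distrib, hsum]; simp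
    rw [h1]
    refine Valuation.map_sum_lt _ one_ne_zero fun k _ => ?_
    have h2 := (U.pow_mem l.2 k)
    have h3 : O.valuation (z ^ k - 1) < 1 := by
      have : O.valuation (((l.1 ^ k) x : ℂ) - 1) < 1 := h2
      rwa [MonoidHom.pow_apply, Units.val_pow_eq_pow_val] at this
    rw [← Valuation.map_neg, neg_sub]; exact h3
  rw [aux_one_le_val O p q hpq hq] at hp1
  exact lt_irrefl _ hp1
end

theorem aux_thmA {G : Type*} [Group G] [Finite G] (x : G) (hgen : Subgroup.closure (conjugatesOf x) = ⊤)
    (p n : ℕ) (hp : p.Prime) (hcard : Nat.card (conjugatesOf x) = p ^ n) (q : ℕ) (hq : q.Prime) (hqp : q ≠ p) :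
    ¬ q ∣ Nat.card (commutator G) := by
  classical
  intro hdvd
  have := Fintype.ofFinite G
  have hq' := Fact.mk hq
  have hpq : Nat.Coprime p q := (Nat.coprime_primes hp hq).2 hqp.symm
  obtain ⟨r, d, hd, ⟨Φ⟩⟩ := IsSemisimpleRing.exists_algEquiv_pi_matrix_of_isAlgClosed ℂ (MonoidAlgebra ℂ G)
  obtain ⟨O, hO, hqO⟩ := aux_val q hq
  have hvp := aux_one_le_val O p q hpq hqO
  have hwex := aux_omega Φ x
  choose w hwint hwK hwtr using hwex
  rw [hcard] at hwtr
  let S : Finset (Fin r) := Finset.univ.filter fun i => O.valuation (w i - ((p ^ n : ℕ) : ℂ)) < 1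
  obtain ⟨e, hee, hec, heΦ⟩ := aux_idem_exists Φ O x (fun i => ⟨w i, hO _ (hwint i)⟩) ((p ^ n : ℕ) : O) hwK S (by
    intro i
    rw [ValuationSubring.valuation_lt_one_iff]
    simp [S])
  have hSd : ∀ i ∈ S, d i = 1 ∨ p ∣ d i := by
    intro i hi
    refine aux_Sdim Φ x hgen p n hp i (w i) (hwint i) ?_ (hwtr i)
    intro h0
    have h1 := (Finset.mem_filter.1 hi).2
    rw [h0, zero_sub, Valuation.map_neg, Nat.cast_pow, map_pow, hvp, one_pow] at h1
    exact lt_irrefl _ h1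
  obtain ⟨y₀, hy₀⟩ := exists_prime_orderOf_dvd_card' q hdvd
  let y : G := y₀
  have hy : orderOf y = q := by rw [← hy₀]; exact Subgroup.orderOf_coe y₀
  let ζ : ℂ := Complex.exp (2 * Real.pi * Complex.I / q)
  have hζ : IsPrimitiveRoot ζ q := Complex.isPrimitiveRoot_exp q hq.ne_zero
  have hζint : IsIntegral ℤ ζ := hζ.isIntegral hq.pos
  let ζO : O := ⟨ζ, hO _ hζint⟩
  have hζOq : ζO ^ q = 1 := Subtype.ext hζ.pow_eq_one
  let z : Oˣ := Units.ofPowEqOne ζO q hζOq hq.ne_zero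
  have hzv : (z : O) = ζO := rfl
  have hzq : z ^ orderOf y = 1 := by
    rw [hy]; apply Units.ext; rw [Units.val_pow_eq_pow_val, hzv, hζOq]; rfl
  have hz1 : (z : O) - 1 ∈ IsLocalRing.maximalIdeal O := by
    rw [hzv]
    obtain ⟨s, hs⟩ := exists_add_pow_prime_eq hq (ζO - 1) 1
    rw [sub_add_cancel, hζOq, one_pow] at hs
    have hqm : ((q : ℕ) : O) ∈ IsLocalRing.maximalIdeal O := by
      rw [ValuationSubring.valuation_lt_one_iff]; simpa using hqO
    have h1 : (ζO - 1) ^ q ∈ IsLocalRing.maximalIdeal O := by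
      have : (ζO - 1) ^ q = (q : O) * (-((ζO - 1) * 1 * s)) := by linear_combination -hs
      rw [this]
      exact Ideal.mul_mem_right _ _ hqm
    exact Ideal.IsPrime.mem_of_pow_mem inferInstance _ h1
  have hmain := aux_group y e hee (hec y) z hzq hz1
  rw [hy, hzv] at hmain
  let T : ℕ → ℂ := fun j => ∑ i ∈ S, (d i : ℂ) * (auxRho Φ i (y ^ j)).trace
  have hT : ∀ j : ℕ, (((Fintype.card G : O) * (e * MonoidAlgebra.single (y ^ j) 1).coeff 1 : O) : ℂ) = T j := by
    intro j
    have h1 := aux_wtrace Φ (MonoidAlgebra.mapRingHom G O.subtype (e * MonoidAlgebra.single (y ^ j) 1))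
    rw [MonoidAlgebra.coeff_mapRingHom] at h1
    have h2 : (((Fintype.card G : O) * (e * MonoidAlgebra.single (y ^ j) 1).coeff 1 : O) : ℂ)
      = (Fintype.card G : ℂ) * O.subtype ((e * MonoidAlgebra.single (y ^ j) 1).coeff 1) := by
      simp
    rw [h2, h1]
    simp only [T]
    rw [← Finset.sum_filter_add_sum_filter_not Finset.univ (· ∈ S)]
    rw [Finset.filter_mem_eq_inter, Finset.univ_inter]
    rw [Finset.sum_eq_zero (s := Finset.filter (fun i => i ∉ S) Finset.univ), add_zero]
    · refine Finset.sum_congr rfl fun i hi => ?_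
      rw [map_mul, map_mul, Pi.mul_apply, heΦ, if_pos hi, one_mul, MonoidAlgebra.mapRingHom_single, map_one]
      rfl
    · intro i hi
      rw [map_mul, map_mul, Pi.mul_apply, heΦ, if_neg (Finset.mem_filter.1 hi).2, zero_mul, Matrix.trace_zero, mul_zero]
  have hmain2 : ∑ j ∈ Finset.range q, ζ ^ j * T j = ∑ j ∈ Finset.range q, T j := by
    have h := congrArg O.subtype hmain
    rw [map_sum, map_sum] at h
    simp only [map_mul O.subtype (_ ^ _), map_pow] at h
    have h3 : ∀ j : ℕ, O.subtype ((Fintype.card G : O) * (e * MonoidAlgebra.single (y ^ j) 1).coeff 1) = T j := hT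
    simp only [h3] at h
    exact h
  let S1 := S.filter fun i => d i = 1
  let S2 := S.filter fun i => ¬ d i = 1
  let β : ℕ → ℂ := fun j => ∑ i ∈ S2, ((d i / p : ℕ) : ℂ) * (auxRho Φ i (y ^ j)).trace
  have hβ : ∀ j, IsIntegral ℤ (β j) := by
    intro j
    refine IsIntegral.sum _ fun i _ => IsIntegral.mul ?_ (aux_tr_int Φ i _)
    exact_mod_cast isIntegral_algebraMap (R := ℤ) (A := ℂ) (x := ((d i / p : ℕ) : ℤ))
  have hTβ : ∀ j, T j = (S1.card : ℂ) + p * β j := by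
    intro j
    simp only [T, β]
    rw [← Finset.sum_filter_add_sum_filter_not S (fun i => d i = 1)]
    congr 1
    · rw [Finset.card_eq_sum_ones, Nat.cast_sum]
      refine Finset.sum_congr rfl fun i hi => ?_
      have hdi := (Finset.mem_filter.1 hi).2
      obtain ⟨l, hl⟩ := aux_lin Φ i hdi
      have hly : l (y ^ j) = 1 := by
        have : y ^ j ∈ l.ker := Abelianization.commutator_subset_ker l (Subgroup.pow_mem _ y₀.2 j)
        exact this
      rw [hl, hly, Units.val_one, map_one, Matrix.trace_one, Fintype.card_fin, hdi]; simp
    · rw [Finset.mul_sum]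
      refine Finset.sum_congr rfl fun i hi => ?_
      have hi' := Finset.mem_filter.1 hi
      obtain ⟨k, hk⟩ := (hSd i hi'.1).resolve_left hi'.2
      rw [← mul_assoc]
      congr 1
      rw [← Nat.cast_mul, Nat.mul_div_cancel' ⟨k, hk⟩]
  have hsum : ∑ j ∈ Finset.range q, ζ ^ j = 0 := hζ.geom_sum_eq_zero hq.one_lt
  have hfin : ((q * S1.card : ℕ) : ℂ) = p * (∑ j ∈ Finset.range q, ζ ^ j * β j - ∑ j ∈ Finset.range q, β j) := by
    simp only [hTβ, mul_add, Finset.sum_add_distrib, ← Finset.sum_mul, hsum, Finset.sum_const,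
      Finset.card_range, nsmul_eq_mul, zero_mul, zero_add] at hmain2
    have h5 : ∑ j ∈ Finset.range q, ζ ^ j * (p * β j) = p * ∑ j ∈ Finset.range q, ζ ^ j * β j := by
      rw [Finset.mul_sum]; exact Finset.sum_congr rfl fun j _ => by ring
    rw [h5, ← Finset.mul_sum] at hmain2
    push_cast
    linear_combination -hmain2
  have hdv := aux_dvd p _ _ ((IsIntegral.sum _ fun j _ => (hζint.pow j).mul (hβ j)).sub
    (IsIntegral.sum _ fun j _ => hβ j)) hfin
  have hdv1 : p ∣ S1.card := hpq.dvd_of_dvd_mul_left hdv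
  apply aux_count Φ O hO p q hp hpq hqO x hgen
  convert hdv1
  rw [Nat.card_eq_fintype_card, Fintype.card_subtype]
  congr 1
  ext i
  simp only [S1, S, Finset.mem_filter, Finset.mem_univ, true_and]
  rw [and_comm]
  refine and_congr_left fun h => ?_
  have h6 := hwtr i
  have hdc : (d i : ℂ) = 1 := by exact_mod_cast h
  rw [hdc, one_mul] at h6
  have h7 : w i - ((p ^ n : ℕ) : ℂ) = (p : ℂ) ^ n * ((auxRho Φ i x).trace - 1) := by
    rw [h6]; push_cast; ring
  rw [h7, map_mul, map_pow, hvp, one_pow, one_mul]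

theorem aux_frat {D : Type*} [Group D] [Finite D] [Group.IsNilpotent D] (H : Subgroup D)
    (h : H ⊔ commutator D = ⊤) : H = ⊤ := by
  rcases eq_top_or_exists_le_coatom H with h1 | ⟨M, hM, hHM⟩
  · exact h1
  exfalso
  have hn : M.Normal := Subgroup.NormalizerCondition.normal_of_coatom M Group.normalizerCondition_of_isNilpotent hM
  have hle : ¬ commutator D ≤ M := by
    intro hc
    exact hM.1 (top_le_iff.1 (h ▸ sup_le hHM hc))
  have htop : M ⊔ commutator D = ⊤ := hM.2 _ (lt_of_le_of_ne le_sup_left (fun heq => hle (heq ▸ le_sup_right)))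
  have hnt : Nontrivial (D ⧸ M) := QuotientGroup.nontrivial_iff.2 hM.1
  have hlt := Group.IsSolvable.commutator_lt_top_of_nontrivial (D ⧸ M)
  apply hlt.ne
  have h1 := congrArg (Subgroup.map (QuotientGroup.mk' M)) htop
  rw [Subgroup.map_sup, QuotientGroup.map_mk'_self, bot_sup_eq, ← MonoidHom.range_eq_map,
    MonoidHom.range_eq_top.2 (QuotientGroup.mk'_surjective M)] at h1
  rw [commutator_def, Subgroup.map_commutator, ← MonoidHom.range_eq_map,
    MonoidHom.range_eq_top.2 (QuotientGroup.mk'_surjective M)] at h1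
  exact h1

section
variable {Q : Type*} [Quandle Q]

theorem QL_apply (a b : Q) : QL a b = a ◃ b := rfl

theorem QL_inv_apply (a b : Q) : (QL a)⁻¹ b = a ◃⁻¹ b := rfl

theorem QL_act (a b : Q) : QL (QL a b) = QL a * QL b * (QL a)⁻¹ := Rack.ad_conj a b

theorem aux_QL_conj (g : Equiv.Perm Q) (hg : g ∈ Subgroup.closure (Set.range (QL : Q → Equiv.Perm Q))) :
    ∀ b, QL (g b) = g * QL b * g⁻¹ := by
  induction hg using Subgroup.closure_induction with
  | mem g hg => obtain ⟨a, rfl⟩ := hg; exact QL_act a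
  | one => intro b; simp
  | mul g h _ _ hg hh =>
    intro b
    rw [Equiv.Perm.mul_apply, hg, hh]; group
  | inv g _ hg =>
    intro b
    have := hg (g⁻¹ b)
    rw [show g (g⁻¹ b) = b from Equiv.apply_symm_apply g b] at this
    rw [this]; group

theorem aux_Dis_le : Dis Q ≤ Subgroup.closure (Set.range (QL : Q → Equiv.Perm Q)) := by
  rw [Dis, Subgroup.closure_le]
  rintro _ ⟨a, b, rfl⟩
  exact mul_mem (Subgroup.subset_closure ⟨a, rfl⟩) (inv_mem (Subgroup.subset_closure ⟨b, rfl⟩))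

theorem aux_Dis_pgroup [Finite Q] (p n : ℕ) (hp : p.Prime) (a : Q)
    (hconn : ∀ x y : Q, ∃ g ∈ Dis Q, g x = y)
    (hcard : Nat.card Q = p ^ n) : IsPGroup p (Dis Q) := by
  let LG := Subgroup.closure (Set.range (QL : Q → Equiv.Perm Q))
  let x : LG := ⟨QL a, Subgroup.subset_closure ⟨a, rfl⟩⟩
  have hmem : ∀ b, QL b ∈ LG := fun b => Subgroup.subset_closure ⟨b, rfl⟩
  have hfin : Finite (Equiv.Perm Q) := inferInstance
  have hgen : Subgroup.closure (conjugatesOf x) = ⊤ := by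
    rw [eq_top_iff, ← Subgroup.closure_closure_coe_preimage (k := Set.range (QL : Q → Equiv.Perm Q))]
    apply Subgroup.closure_mono
    rintro ⟨c, hc⟩ ⟨b, hb⟩
    obtain ⟨g, hg, hgb⟩ := hconn a b
    refine isConj_iff.2 ⟨⟨g, aux_Dis_le hg⟩, ?_⟩
    apply Subtype.ext
    change g * QL a * g⁻¹ = c
    rw [← aux_QL_conj g (aux_Dis_le hg), hgb, hb]
  have htrans : MulAction.IsPretransitive LG Q := by
    refine ⟨fun u v => ?_⟩
    obtain ⟨g, hg, hgb⟩ := hconn u v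
    exact ⟨⟨g, aux_Dis_le hg⟩, hgb⟩
  have hdvd : Nat.card (conjugatesOf x) ∣ p ^ n := by
    have h1 : (MulAction.stabilizer LG a).index = p ^ n := by
      rw [MulAction.index_stabilizer_of_transitive, hcard]
    have h2 : ((MulAction.stabilizer (ConjAct LG) x).comap (ConjAct.toConjAct : LG ≃* ConjAct LG).toMonoidHom).index
        = Nat.card (conjugatesOf x) := by
      rw [Subgroup.index_comap_of_surjective _ (ConjAct.toConjAct : LG ≃* ConjAct LG).surjective,
        MulAction.index_stabilizer, ConjAct.orbit_eq_carrier_conjClasses, ConjClasses.carrier_eq_preimage_mk,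
        Nat.card_coe_set_eq]
      congr 1
      ext c
      change ConjClasses.mk c = ConjClasses.mk x ↔ IsConj x c
      rw [ConjClasses.mk_eq_mk_iff_isConj]
      exact ⟨IsConj.symm, IsConj.symm⟩
    rw [← h1, ← h2]
    apply Subgroup.index_dvd_of_le
    intro g hg
    have hg' : g.1 a = a := hg
    change ConjAct.toConjAct g • x = x
    rw [ConjAct.toConjAct_smul]
    apply Subtype.ext
    change g.1 * QL a * g.1⁻¹ = QL a
    rw [← aux_QL_conj g.1 g.2, hg']
  obtain ⟨m, -, hm⟩ := (Nat.dvd_prime_pow hp).1 hdvd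
  have hA := aux_thmA x hgen p m hp hm
  have hcp : IsPGroup p (commutator LG) := by
    apply IsPGroup.of_card (n := (Nat.card (commutator LG)).primeFactorsList.length)
    apply Nat.eq_prime_pow_of_unique_prime_dvd Nat.card_pos.ne'
    intro q hq hqd
    by_contra hne
    exact hA q hq hne hqd
  refine IsPGroup.to_le (hcp.map LG.subtype) ?_
  rw [Dis, Subgroup.closure_le]
  rintro _ ⟨b, c, rfl⟩
  obtain ⟨g, hg, hgb⟩ := hconn c b
  let g' : LG := ⟨g, aux_Dis_le hg⟩
  let c' : LG := ⟨QL c, hmem c⟩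
  refine ⟨g' * c' * g'⁻¹ * c'⁻¹,
    Subgroup.commutator_mem_commutator (Subgroup.mem_top g') (Subgroup.mem_top c'), ?_⟩
  change g * QL c * g⁻¹ * (QL c)⁻¹ = _
  rw [← aux_QL_conj g (aux_Dis_le hg), hgb]

theorem aux_Dis_conj (a : Q) (g : Equiv.Perm Q) (hg : g ∈ Dis Q) : QL a * g * (QL a)⁻¹ ∈ Dis Q := by
  unfold Dis at hg
  induction hg using Subgroup.closure_induction with
  | mem g hg =>
    obtain ⟨b, c, rfl⟩ := hg
    apply Subgroup.subset_closure
    refine ⟨QL a b, QL a c, ?_⟩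
    rw [QL_act, QL_act]; group
  | one => rw [mul_one, mul_inv_cancel]; exact one_mem _
  | mul g h _ _ hg hh =>
    have := mul_mem hg hh
    convert this using 1
    group
  | inv g _ hg =>
    have := inv_mem hg
    convert this using 1
    group

theorem aux_index [Finite Q] (p n : ℕ) (a : Q)
    (hconn : ∀ x y : Q, ∃ g ∈ Dis Q, g x = y)
    (hcard : Nat.card Q = p ^ n) : (commutator (Dis Q)).index ∣ p ^ n := by
  have hfin : Finite (Equiv.Perm Q) := inferInstance
  have htrans : MulAction.IsPretransitive (Dis Q) Q := by
    refine ⟨fun u v => ?_⟩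
    obtain ⟨g, hg, hgb⟩ := hconn u v
    exact ⟨⟨g, hg⟩, hgb⟩
  have h1 : (MulAction.stabilizer (Dis Q) a).index = p ^ n := by
    rw [MulAction.index_stabilizer_of_transitive, hcard]
  rw [← h1]
  apply Subgroup.index_dvd_of_le
  let φ : Dis Q →* Dis Q :=
    { toFun := fun g => ⟨QL a * g.1 * (QL a)⁻¹, aux_Dis_conj a g.1 g.2⟩
      map_one' := Subtype.ext (by simp)
      map_mul' := fun g h => Subtype.ext (by simp [mul_assoc]) }
  let ψ : Abelianization (Dis Q) →* Abelianization (Dis Q) := MonoidHom.id _ / Abelianization.map φ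
  have hψ : ∀ g : Dis Q, ψ (Abelianization.of g) = Abelianization.of (g * (φ g)⁻¹) := by
    intro g
    change Abelianization.of g / Abelianization.map φ (Abelianization.of g) = _
    rw [Abelianization.map_of, map_mul, map_inv, div_eq_mul_inv]
  have hb : ∀ b, ∀ hm : QL b * (QL a)⁻¹ ∈ Dis Q, Abelianization.of (⟨_, hm⟩ : Dis Q) ∈ ψ.range := by
    intro b hm
    obtain ⟨g, hg, hgb⟩ := hconn a b
    refine ⟨Abelianization.of ⟨g, hg⟩, ?_⟩
    rw [hψ]
    congr 1
    apply Subtype.ext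
    change g * (QL a * g * (QL a)⁻¹)⁻¹ = QL b * (QL a)⁻¹
    rw [← hgb, aux_QL_conj g (aux_Dis_le hg)]; group
  have hmemD : ∀ b c : Q, QL b * (QL c)⁻¹ ∈ Dis Q := fun b c => Subgroup.subset_closure ⟨b, c, rfl⟩
  have hall : ∀ g, ∀ hg : g ∈ Dis Q, Abelianization.of (⟨g, hg⟩ : Dis Q) ∈ ψ.range := by
    intro g hg
    refine Subgroup.closure_induction (p := fun g hg => Abelianization.of (⟨g, hg⟩ : Dis Q) ∈ ψ.range)
      ?_ ?_ ?_ ?_ hg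
    · rintro _ ⟨b, c, rfl⟩
      have := mul_mem (hb b (hmemD b a)) (inv_mem (hb c (hmemD c a)))
      rw [← map_inv, ← map_mul] at this
      convert this using 2
      apply Subtype.ext
      change QL b * (QL c)⁻¹ = QL b * (QL a)⁻¹ * (QL c * (QL a)⁻¹)⁻¹
      group
    · have := one_mem ψ.range
      rw [← map_one Abelianization.of] at this
      exact this
    · intro g h hg hh h1 h2
      have := mul_mem h1 h2
      rw [← map_mul] at this
      exact this
    · intro g hg h1
      have := inv_mem h1
      rw [← map_inv] at this
      exact this
  have hsurj : Function.Surjective ψ := by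
    intro v
    obtain ⟨g, rfl⟩ := QuotientGroup.mk_surjective v
    exact hall g.1 g.2
  have hfinA : Finite (Abelianization (Dis Q)) := Finite.of_surjective _ (QuotientGroup.mk_surjective)
  have hinj : Function.Injective ψ := Finite.injective_iff_surjective.2 hsurj
  intro h hh
  have hha : h.1 a = a := hh
  rw [← Abelianization.ker_of, MonoidHom.mem_ker]
  apply hinj
  rw [hψ, map_one]
  have : h * (φ h)⁻¹ = 1 := by
    apply Subtype.ext
    change h.1 * (QL a * h.1 * (QL a)⁻¹)⁻¹ = 1
    have h3 := aux_QL_conj h.1 (aux_Dis_le h.2) a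
    rw [hha] at h3
    have h4 : h.1 * (QL a * h.1 * (QL a)⁻¹)⁻¹ = (h.1 * QL a * h.1⁻¹) * (QL a)⁻¹ := by group
    rw [h4, ← h3, mul_inv_cancel]
  rw [this, map_one]

/-- The subgroup of the displacement group attached to a set of elements. -/
def auxC (a : Q) (S : Finset Q) : Subgroup (Dis Q) :=
  Subgroup.closure {g : Dis Q | ∃ s ∈ S, g.1 = QL s * (QL a)⁻¹}

theorem auxC_top (a : Q) (H : Subgroup (Dis Q)) (h : ∀ g : Dis Q, ∀ b, g.1 = QL b * (QL a)⁻¹ → g ∈ H) : H = ⊤ := by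
  rw [eq_top_iff]
  rintro ⟨g, hg⟩ -
  have hmemD : ∀ b c : Q, QL b * (QL c)⁻¹ ∈ Dis Q := fun b c => Subgroup.subset_closure ⟨b, c, rfl⟩
  refine Subgroup.closure_induction (p := fun g hg => (⟨g, hg⟩ : Dis Q) ∈ H) ?_ ?_ ?_ ?_ hg
  · rintro _ ⟨b, c, rfl⟩
    have := mul_mem (h ⟨_, hmemD b a⟩ b rfl) (inv_mem (h ⟨_, hmemD c a⟩ c rfl))
    convert this using 1
    apply Subtype.ext
    change QL b * (QL c)⁻¹ = QL b * (QL a)⁻¹ * (QL c * (QL a)⁻¹)⁻¹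
    group
  · exact one_mem H
  · intro g h hg hh h1 h2
    exact mul_mem h1 h2
  · intro g hg h1
    exact inv_mem h1

theorem aux_greedy [Finite Q] (p n : ℕ) (hp : p.Prime) (a : Q)
    (hidx : (commutator (Dis Q)).index ∣ p ^ n) (k : ℕ) :
    ∃ S : Finset Q, S.card ≤ k + 1 ∧ a ∈ S ∧
      ((auxC a S ⊔ commutator (Dis Q)) = ⊤ ∨ (auxC a S ⊔ commutator (Dis Q)).index * p ^ k ∣ p ^ n) := by
  classical
  induction k with
  | zero =>
    refine ⟨{a}, by simp, by simp, Or.inr ?_⟩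
    rw [pow_zero, mul_one]
    exact (Subgroup.index_dvd_of_le le_sup_right).trans hidx
  | succ k ih =>
    obtain ⟨S, hS, ha, h⟩ := ih
    by_cases htop : auxC a S ⊔ commutator (Dis Q) = ⊤
    · exact ⟨S, by omega, ha, Or.inl htop⟩
    have hd := h.resolve_left htop
    have hex : ∃ g : Dis Q, ∃ b, g.1 = QL b * (QL a)⁻¹ ∧ g ∉ auxC a S ⊔ commutator (Dis Q) := by
      by_contra hcon
      push Not at hcon
      exact htop (auxC_top a _ hcon)
    obtain ⟨g, b, hgb, hg⟩ := hex
    refine ⟨insert b S, (Finset.card_insert_le _ _).trans (by omega), Finset.mem_insert_of_mem ha, Or.inr ?_⟩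
    have hle : auxC a S ⊔ commutator (Dis Q) ≤ auxC a (insert b S) ⊔ commutator (Dis Q) := by
      apply sup_le_sup_right
      apply Subgroup.closure_mono
      rintro g ⟨s, hs, hgs⟩
      exact ⟨s, Finset.mem_insert_of_mem hs, hgs⟩
    have hmul := Subgroup.relIndex_mul_index hle
    have hne : (auxC a S ⊔ commutator (Dis Q)).relIndex (auxC a (insert b S) ⊔ commutator (Dis Q)) ≠ 1 := by
      intro h1
      rw [Subgroup.relIndex_eq_one] at h1
      exact hg (h1 (Subgroup.mem_sup_left (Subgroup.subset_closure ⟨b, Finset.mem_insert_self _ _, hgb⟩)))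
    have hpd : p ∣ (auxC a S ⊔ commutator (Dis Q)).relIndex (auxC a (insert b S) ⊔ commutator (Dis Q)) := by
      have h2 : (auxC a S ⊔ commutator (Dis Q)).relIndex (auxC a (insert b S) ⊔ commutator (Dis Q)) ∣ p ^ n :=
        (Dvd.intro _ hmul).trans ((Dvd.intro _ rfl).trans hd)
      obtain ⟨m, -, hm⟩ := (Nat.dvd_prime_pow hp).1 h2
      rw [hm] at hne ⊢
      exact dvd_pow_self p (fun h0 => hne (by rw [h0, pow_zero]))
    refine dvd_trans ?_ hd
    rw [← hmul, pow_succ]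
    obtain ⟨t, ht⟩ := hpd
    rw [ht]
    exact ⟨t, by ring⟩
end

theorem stmt18 (p n : ℕ) (hp : p.Prime) (Q : Type*) [Quandle Q]
    (hconn : ∀ x y : Q, ∃ g ∈ Dis Q, g x = y)
    (hcard : Nat.card Q = p ^ n) :
    ∃ S : Finset Q, S.card ≤ n + 1 ∧
      ∀ T : Set Q, ↑S ⊆ T →
        (∀ a ∈ T, ∀ b ∈ T, a ◃ b ∈ T ∧ a ◃⁻¹ b ∈ T) → T = Set.univ := by
  have hpos : 0 < Nat.card Q := by rw [hcard]; exact pow_pos hp.pos n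
  obtain ⟨⟨a⟩, hfinQ⟩ := Nat.card_pos_iff.1 hpos
  have hfin : Finite (Equiv.Perm Q) := inferInstance
  have hfact := Fact.mk hp
  have hpg := aux_Dis_pgroup p n hp a hconn hcard
  have hnil : Group.IsNilpotent (Dis Q) := hpg.isNilpotent
  obtain ⟨S, hS, ha, h⟩ := aux_greedy p n hp a (aux_index p n a hconn hcard) n
  have htop : auxC a S ⊔ commutator (Dis Q) = ⊤ := by
    rcases h with h | h
    · exact h
    · rw [← Subgroup.index_eq_one]
      have h1 : (auxC a S ⊔ commutator (Dis Q)).index * p ^ n ∣ 1 * p ^ n := by rw [one_mul]; exact h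
      exact Nat.dvd_one.1 (Nat.dvd_of_mul_dvd_mul_right (pow_pos hp.pos n) h1)
  have hC : auxC a S = ⊤ := aux_frat _ htop
  refine ⟨S, hS, fun T hST hT => ?_⟩
  have haT : a ∈ T := hST ha
  have key : ∀ g : Dis Q, g ∈ auxC a S → ∀ t ∈ T, g.1 t ∈ T ∧ (g⁻¹).1 t ∈ T := by
    intro g hg
    unfold auxC at hg
    induction hg using Subgroup.closure_induction with
    | mem g hg =>
      obtain ⟨s, hs, hgs⟩ := hg
      intro t ht
      constructor
      · rw [hgs]
        exact (hT s (hST hs) _ (hT a haT t ht).2).1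
      · rw [Subgroup.coe_inv, hgs, mul_inv_rev, inv_inv]
        exact (hT a haT _ (hT s (hST hs) t ht).2).1
    | one => intro t ht; simpa using ht
    | mul g h _ _ hg hh =>
      intro t ht
      constructor
      · exact (hg _ (hh t ht).1).1
      · rw [mul_inv_rev]
        exact (hh _ (hg t ht).2).2
    | inv g _ hg =>
      intro t ht
      rw [inv_inv]
      exact (hg t ht).symm
  rw [Set.eq_univ_iff_forall]
  intro b
  obtain ⟨g, hg, hgb⟩ := hconn a b
  have := (key ⟨g, hg⟩ (by rw [hC]; trivial) a haT).1
  rw [← hgb]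
  exact this
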